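/- Let w ≥ 1 and let α, β ≥ 1. Let a : Fin α → ℕ and b : Fin β → ℕ be sequences of positive integers with ∑ a i ≤ w - 1, ∑ b j ≤ w - 1, and α + β ≥ w + 1. Then there exist indices 1 ≤ c < c' ≤ α and 1 ≤ d < d' ≤ β such that the sum of the first c terms of a equals the sum of the first d terms of b, and the sum of the first c' terms of a equals the sum of the first d' terms of b. Equivalently, there exist disjoint nonempty consecutive blocks A₁ = {1,…,c}, A₂ = {c+1,…,c'} of indices of a and B₁ = {1,…,d}, B₂ = {d+1,…,d'} of indices of b with ∑_{i ∈ A₁} a i = ∑_{j ∈ B₁} b j and ∑_{i ∈ A₂} a i = ∑_{j ∈ B₂} b j. -/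

import Mathlib

/-- The sum of the first `c` terms of the sequence `a : Fin n → ℕ`. -/
def prefixSum {n : ℕ} (a : Fin n → ℕ) (c : ℕ) : ℕ :=
  ∑ i : Fin n, if (i : ℕ) < c then a i else 0

theorem prefixSum_le_sum {n : ℕ} (a : Fin n → ℕ) (c : ℕ) : prefixSum a c ≤ ∑ i, a i := by
  refine Finset.sum_le_sum fun i _ => ?_
  split_ifs <;> simp

theorem prefixSum_lt_prefixSum {n : ℕ} {a : Fin n → ℕ} (ha : ∀ i, 1 ≤ a i) {c c' : ℕ}
    (h : c < c') (hc' : c' ≤ n) : prefixSum a c < prefixSum a c' := by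
  refine Finset.sum_lt_sum (fun i _ => ?_) ⟨⟨c, by omega⟩, Finset.mem_univ _, ?_⟩
  · split_ifs <;> omega
  · have := ha ⟨c, by omega⟩
    simp only [lt_irrefl, if_false, if_pos h]
    omega

theorem prefixSum_strictMonoOn {n : ℕ} {a : Fin n → ℕ} (ha : ∀ i, 1 ≤ a i) :
    StrictMonoOn (prefixSum a) (Set.Icc 1 n) :=
  fun _ _ _ hc' h => prefixSum_lt_prefixSum ha h hc'.2

/-- The set of prefix sums of `a` over nonempty prefixes. -/
def prefixSums {n : ℕ} (a : Fin n → ℕ) : Finset ℕ :=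
  (Finset.Icc 1 n).image (prefixSum a)

theorem card_prefixSums {n : ℕ} {a : Fin n → ℕ} (ha : ∀ i, 1 ≤ a i) :
    (prefixSums a).card = n := by
  rw [prefixSums, Finset.card_image_of_injOn, Nat.card_Icc, Nat.add_sub_cancel]
  rw [Finset.coe_Icc]
  exact (prefixSum_strictMonoOn ha).injOn

theorem prefixSums_subset_Icc {n m : ℕ} {a : Fin n → ℕ} (ha : ∀ i, 1 ≤ a i)
    (hs : ∑ i, a i ≤ m) : prefixSums a ⊆ Finset.Icc 1 m := by
  refine Finset.image_subset_iff.2 fun c hc => ?_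
  rw [Finset.mem_Icc] at hc ⊢
  have h := prefixSum_lt_prefixSum ha hc.1 hc.2
  exact ⟨by omega, (prefixSum_le_sum a c).trans hs⟩

/-- Two sequences of positive integers, each summing to at most `w-1`, with at least
`w+1` terms in total, have two distinct common prefix sums. -/
theorem matching_prefix_sums {w α β : ℕ} (hw : 1 ≤ w) (hα : 1 ≤ α) (hβ : 1 ≤ β)
    (a : Fin α → ℕ) (b : Fin β → ℕ)
    (ha : ∀ i, 1 ≤ a i) (hb : ∀ j, 1 ≤ b j)
    (hsa : ∑ i, a i ≤ w - 1) (hsb : ∑ j, b j ≤ w - 1)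
    (hn : w + 1 ≤ α + β) :
    ∃ c c' d d' : ℕ, 1 ≤ c ∧ c < c' ∧ c' ≤ α ∧ 1 ≤ d ∧ d < d' ∧ d' ≤ β ∧
      prefixSum a c = prefixSum b d ∧ prefixSum a c' = prefixSum b d' := by
  have hunion : (prefixSums a ∪ prefixSums b).card ≤ w - 1 := by
    simpa using Finset.card_le_card
      (Finset.union_subset (prefixSums_subset_Icc ha hsa) (prefixSums_subset_Icc hb hsb))
  have hcard := Finset.card_union_add_card_inter (prefixSums a) (prefixSums b)
  rw [card_prefixSums ha, card_prefixSums hb] at hcard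
  obtain ⟨x, hx, y, hy, hxy⟩ :=
    Finset.one_lt_card.1 (show 1 < (prefixSums a ∩ prefixSums b).card by omega)
  wlog hlt : x < y generalizing x y
  · exact this y hy x hx hxy.symm (by omega)
  simp only [prefixSums, Finset.mem_inter, Finset.mem_image, Finset.mem_Icc] at hx hy
  obtain ⟨⟨c, hc, hac⟩, d, hd, hbd⟩ := hx
  obtain ⟨⟨c', hc', hac'⟩, d', hd', hbd'⟩ := hy
  refine ⟨c, c', d, d', hc.1, ?_, hc'.2, hd.1, ?_, hd'.2, hac.trans hbd.symm,
    hac'.trans hbd'.symm⟩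
  · exact ((prefixSum_strictMonoOn ha).lt_iff_lt hc hc').1 (by omega)
  · exact ((prefixSum_strictMonoOn hb).lt_iff_lt hd hd').1 (by omega)
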